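/- arXiv:2004.12658 — 4 statements merged into one kernel-verified Lean document; each statement's English description precedes it below -/
import Mathlib

section
/- Let n ≥ 1, s > 0, and let φ be a Schwartz function on ℝⁿ. Then for every x ∈ ℝⁿ: (2π)^{−n/2} ∫_{ℝⁿ} e^{i x·ξ} e^{−i s|ξ|²/2} φ̂(ξ) dξ = s^{−n/2} e^{−iπn/4} e^{i|x|²/(2s)} · (2π)^{−n/2} ∫_{ℝⁿ} e^{−i (x/s)·y} e^{i|y|²/(2s)} φ(y) dy, where φ̂(ξ) := (2π)^{−n/2} ∫_{ℝⁿ} e^{−i y·ξ} φ(y) dy. -/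
open Real Complex MeasureTheory SchwartzMap
open scoped RealInnerProductSpace

open Filter Topology Module

section GaussianFourier

variable {V : Type*} [NormedAddCommGroup V] [InnerProductSpace ℝ V] [FiniteDimensional ℝ V]
  [MeasurableSpace V] [BorelSpace V]

/-- Pairing a modulated Gaussian with a Fourier transform gives a Gaussian convolution. -/
theorem integral_gaussian_mul_fourier {b : ℂ} (hb : 0 < b.re) {f : V → ℂ} (hf : Integrable f)
    (x : V) :
    ∫ ξ : V, cexp (-b * (‖ξ‖ ^ 2 : ℝ)) *
        (cexp (I * (⟪x, ξ⟫ : ℝ)) * ∫ y : V, cexp (-I * (⟪y, ξ⟫ : ℝ)) * f y) =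
      (π / b) ^ (finrank ℝ V / 2 : ℂ) * ∫ y : V, cexp (-(4 * b)⁻¹ * (‖x - y‖ ^ 2 : ℝ)) * f y := by
  have hg : Integrable (fun ξ : V ↦ cexp (-b * ‖ξ‖ ^ 2 + I * ⟪x, ξ⟫)) :=
    GaussianFourier.integrable_cexp_neg_mul_sq_norm_add hb I x
  have h := VectorFourier.integral_fourierIntegral_smul_eq_flip (L := innerₗ V)
    (μ := volume) (ν := volume) Real.continuous_probChar continuous_inner hf hg
  simp only [VectorFourier.fourierIntegral_probChar, smul_eq_mul, innerₗ_apply_apply,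
    LinearMap.flip_apply] at h
  rw [← integral_const_mul]
  convert! h using 2
  · ext ξ
    rw [Complex.exp_add]
    push_cast
    simp only [neg_mul, mul_comm I]
    ring
  · ext y
    have h' := GaussianFourier.integral_cexp_neg_mul_sq_norm_add hb I (x - y)
    have hy : ∫ ξ : V, cexp (-(⟪y, ξ⟫ : ℝ) * I) * cexp (-b * ‖ξ‖ ^ 2 + I * ⟪x, ξ⟫) =
        ∫ ξ : V, cexp (-b * ‖ξ‖ ^ 2 + I * ⟪x - y, ξ⟫) := by
      congr with ξ
      rw [← Complex.exp_add, inner_sub_left]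
      push_cast
      ring_nf
    rw [hy, h', I_sq]
    push_cast
    ring_nf

/-- Damping by a complex Gaussian factor depends continuously on its parameter in the closed
right half-plane. -/
theorem tendsto_integral_cexp_neg_mul {ι : Type*} {l : Filter ι} [l.IsCountablyGenerated]
    {b : ι → ℂ} {b₀ : ℂ} (hb : Tendsto b l (𝓝 b₀)) (hb_re : ∀ᶠ i in l, 0 ≤ (b i).re)
    {q : V → ℝ} (hq : Continuous q) (hq0 : ∀ v, 0 ≤ q v) {f : V → ℂ} (hf : Integrable f) :
    Tendsto (fun i ↦ ∫ v, cexp (-b i * q v) * f v) l (𝓝 (∫ v, cexp (-b₀ * q v) * f v)) := by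
  refine tendsto_integral_filter_of_dominated_convergence (fun v ↦ ‖f v‖) ?_ ?_ hf.norm ?_
  · filter_upwards with i
    exact (Continuous.aestronglyMeasurable (by fun_prop)).mul hf.1
  · filter_upwards [hb_re] with i hi
    filter_upwards with v
    rw [norm_mul, Complex.norm_exp]
    refine mul_le_of_le_one_left (norm_nonneg _) (Real.exp_le_one_iff.2 ?_)
    simpa using mul_nonneg hi (hq0 v)
  · filter_upwards with v
    exact ((Complex.continuous_exp.tendsto _).comp (hb.neg.mul_const _)).mul_const _

/-- `integral_gaussian_mul_fourier` extended to the boundary of the half-plane, for functions with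
integrable Fourier transform. -/
theorem integral_gaussian_mul_fourier_of_nonneg {b : ℂ} (hb : 0 ≤ b.re) (hb0 : b ≠ 0) {f : V → ℂ}
    (hf : Integrable f) (hf' : Integrable (fun ξ ↦ ∫ y : V, cexp (-I * (⟪y, ξ⟫ : ℝ)) * f y))
    (x : V) :
    ∫ ξ : V, cexp (-b * (‖ξ‖ ^ 2 : ℝ)) *
        (cexp (I * (⟪x, ξ⟫ : ℝ)) * ∫ y : V, cexp (-I * (⟪y, ξ⟫ : ℝ)) * f y) =
      (π / b) ^ (finrank ℝ V / 2 : ℂ) * ∫ y : V, cexp (-(4 * b)⁻¹ * (‖x - y‖ ^ 2 : ℝ)) * f y := by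
  let c : ℝ → ℂ := fun ε ↦ b + ε
  have hc : Tendsto c (𝓝[>] 0) (𝓝 b) := by
    have : Continuous c := by fun_prop
    simpa [c] using (this.tendsto 0).mono_left nhdsWithin_le_nhds
  have hc_re : ∀ᶠ ε in 𝓝[>] (0 : ℝ), 0 < (c ε).re := by
    filter_upwards [self_mem_nhdsWithin] with ε hε
    simpa [c] using add_pos_of_nonneg_of_pos hb hε
  have hmod : Integrable fun ξ : V ↦
      cexp (I * (⟪x, ξ⟫ : ℝ)) * ∫ y : V, cexp (-I * (⟪y, ξ⟫ : ℝ)) * f y := by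
    refine hf'.bdd_mul (c := 1) (Continuous.aestronglyMeasurable (by fun_prop)) ?_
    filter_upwards with ξ
    rw [mul_comm, Complex.norm_exp_ofReal_mul_I]
  have hl := tendsto_integral_cexp_neg_mul hc (hc_re.mono fun _ ↦ le_of_lt)
    (q := fun ξ : V ↦ ‖ξ‖ ^ 2) (by fun_prop) (fun _ ↦ by positivity) hmod
  have hr := tendsto_integral_cexp_neg_mul (b := fun ε ↦ (4 * c ε)⁻¹)
    ((hc.const_mul 4).inv₀ (by simpa using hb0))
    (hc_re.mono fun ε hε ↦ by
      rw [Complex.inv_re]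
      exact div_nonneg (by simpa using hε.le) (Complex.normSq_nonneg _))
    (q := fun y : V ↦ ‖x - y‖ ^ 2) (by fun_prop) (fun _ ↦ by positivity) hf
  have hslit : (π / b : ℂ) ∈ slitPlane := by
    have hn : 0 < normSq b := normSq_pos.2 hb0
    rw [mem_slitPlane_iff, div_re, div_im]
    by_cases h : b.re = 0
    · right
      have : b.im ≠ 0 := fun h' ↦ hb0 (Complex.ext h h')
      simp [h, this, hb0, Real.pi_ne_zero]
    · left
      have : 0 < b.re := lt_of_le_of_ne hb (Ne.symm h)
      simp only [ofReal_re, ofReal_im, zero_mul, zero_div, add_zero]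
      positivity
  have hpow : Tendsto (fun ε ↦ (π / c ε : ℂ) ^ (finrank ℝ V / 2 : ℂ)) (𝓝[>] 0)
      (𝓝 ((π / b : ℂ) ^ (finrank ℝ V / 2 : ℂ))) :=
    (tendsto_const_nhds.div hc hb0).cpow tendsto_const_nhds hslit
  refine tendsto_nhds_unique hl ((hpow.mul hr).congr' ?_)
  filter_upwards [hc_re] with ε hε
  exact (integral_gaussian_mul_fourier hε hf x).symm

/-- The Fourier transform of a Schwartz function, without `2π` in the phase, is integrable. -/
theorem SchwartzMap.integrable_integral_cexp_neg_I_mul_inner (φ : SchwartzMap V ℂ) :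
    Integrable (fun ξ : V ↦ ∫ y : V, cexp (-I * (⟪y, ξ⟫ : ℝ)) * φ y) := by
  have h := (FourierTransform.fourier φ).integrable (μ := volume)
  convert! h.comp_smul (R := (2 * π)⁻¹) (by positivity) using 2 with ξ
  rw [SchwartzMap.fourier_coe, Real.fourier_eq']
  congr with y
  rw [inner_smul_right, smul_eq_mul]
  congr 2
  push_cast
  field_simp

end GaussianFourier

/-- The branch `(is)^{-r} = s^{-r} e^{-iπr/2}` for `s > 0`. -/
theorem Complex.cpow_pi_div_I_mul {s : ℝ} (hs : 0 < s) (r : ℝ) :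
    (π / (I * s / 2) : ℂ) ^ (r / 2 : ℂ) =
      ((2 * π) ^ (r / 2) : ℝ) * ((s ^ (-r / 2) : ℝ) * cexp (-I * π * r / 4)) := by
  have h : (π / (I * s / 2) : ℂ) = ((2 * π / s : ℝ) : ℂ) * -I := by
    have : (s : ℂ) ≠ 0 := ofReal_ne_zero.2 hs.ne'
    push_cast
    field_simp
    simp
  have h2 : (2 * π / s : ℝ) ≠ 0 := by positivity
  rw [h, cpow_def_of_ne_zero (mul_ne_zero (ofReal_ne_zero.2 h2) (neg_ne_zero.2 I_ne_zero)),
    log_ofReal_mul (by positivity) (neg_ne_zero.2 I_ne_zero), log_neg_I,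
    Real.log_div (by positivity) hs.ne', Real.rpow_def_of_pos (by positivity),
    Real.rpow_def_of_pos hs]
  push_cast
  rw [← Complex.exp_add, ← Complex.exp_add]
  ring_nf

/-- MDFM decomposition of the free Schrödinger propagator, pointwise: for a Schwartz
function `φ` on `ℝⁿ`, `s > 0`, and all `x`,
`(e^{-isp²/2}φ)(x) = s^{-n/2} e^{-iπn/4} e^{i|x|²/(2s)} (ℱ[e^{i|·|²/(2s)}φ])(x/s)`. -/
theorem stmt_9 (n : ℕ) (hn : 1 ≤ n) (s : ℝ) (hs : 0 < s)
    (φ : SchwartzMap (EuclideanSpace ℝ (Fin n)) ℂ)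
    (φhat : EuclideanSpace ℝ (Fin n) → ℂ)
    (hφhat : ∀ ξ, φhat ξ =
      ((2 * Real.pi) ^ (-(n : ℝ) / 2) : ℝ) *
        ∫ y : EuclideanSpace ℝ (Fin n),
          Complex.exp (-Complex.I * (⟪y, ξ⟫ : ℝ)) * φ y) :
    ∀ x : EuclideanSpace ℝ (Fin n),
      ((2 * Real.pi) ^ (-(n : ℝ) / 2) : ℝ) *
          ∫ ξ : EuclideanSpace ℝ (Fin n),
            Complex.exp (Complex.I * (⟪x, ξ⟫ : ℝ)) *
              Complex.exp (-Complex.I * s * (‖ξ‖ ^ 2 : ℝ) / 2) * φhat ξ =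
        ((s ^ (-(n : ℝ) / 2) : ℝ) : ℂ) * Complex.exp (-Complex.I * Real.pi * n / 4) *
          Complex.exp (Complex.I * (‖x‖ ^ 2 : ℝ) / (2 * s)) *
          (((2 * Real.pi) ^ (-(n : ℝ) / 2) : ℝ) *
            ∫ y : EuclideanSpace ℝ (Fin n),
              Complex.exp (-Complex.I * (⟪s⁻¹ • x, y⟫ : ℝ)) *
                Complex.exp (Complex.I * (‖y‖ ^ 2 : ℝ) / (2 * s)) * φ y) := by
  intro x
  have hs' : (s : ℂ) ≠ 0 := ofReal_ne_zero.2 hs.ne'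
  have key := integral_gaussian_mul_fourier_of_nonneg (b := I * s / 2) (by simp)
    (by simp [hs.ne']) φ.integrable φ.integrable_integral_cexp_neg_I_mul_inner x
  have hc : (((2 * π) ^ (-(n : ℝ) / 2) : ℝ) : ℂ) * ((2 * π) ^ ((n : ℝ) / 2) : ℝ) = 1 := by
    rw [← ofReal_mul, ← Real.rpow_add (by positivity)]
    simp [neg_div]
  have hpow := Complex.cpow_pi_div_I_mul hs n
  rw [ofReal_natCast] at hpow
  rw [finrank_euclideanSpace_fin, hpow] at key
  have hL : ∫ ξ : EuclideanSpace ℝ (Fin n), cexp (I * (⟪x, ξ⟫ : ℝ)) *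
        cexp (-I * s * (‖ξ‖ ^ 2 : ℝ) / 2) * φhat ξ =
      ((2 * π) ^ (-(n : ℝ) / 2) : ℝ) * ∫ ξ : EuclideanSpace ℝ (Fin n),
        cexp (-(I * s / 2) * (‖ξ‖ ^ 2 : ℝ)) * (cexp (I * (⟪x, ξ⟫ : ℝ)) *
          ∫ y : EuclideanSpace ℝ (Fin n), cexp (-I * (⟪y, ξ⟫ : ℝ)) * φ y) := by
    rw [← integral_const_mul]
    congr with ξ
    rw [hφhat, show -I * s * ((‖ξ‖ ^ 2 : ℝ) : ℂ) / 2 = -(I * s / 2) * (‖ξ‖ ^ 2 : ℝ) by ring]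
    ring
  have hR : ∫ y, cexp (-(4 * (I * s / 2))⁻¹ * (‖x - y‖ ^ 2 : ℝ)) * φ y =
      cexp (I * (‖x‖ ^ 2 : ℝ) / (2 * s)) * ∫ y : EuclideanSpace ℝ (Fin n),
        cexp (-I * (⟪s⁻¹ • x, y⟫ : ℝ)) * cexp (I * (‖y‖ ^ 2 : ℝ) / (2 * s)) * φ y := by
    rw [← integral_const_mul]
    congr with y
    rw [← mul_assoc, ← Complex.exp_add, ← Complex.exp_add, norm_sub_sq_real, inner_smul_left]
    congr 2
    have hI : -(4 * (I * s / 2))⁻¹ = I / (2 * s) := by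
      field_simp
      rw [I_sq]
      norm_num
    rw [hI]
    simp only [conj_trivial]
    push_cast
    field_simp
    ring
  rw [hL, key, hR]
  linear_combination (((2 * π) ^ (-(n : ℝ) / 2) : ℝ) * ((s ^ (-(n : ℝ) / 2) : ℝ) : ℂ) *
    cexp (-I * π * n / 4) * cexp (I * (‖x‖ ^ 2 : ℝ) / (2 * s)) *
    ∫ y : EuclideanSpace ℝ (Fin n), cexp (-I * (⟪s⁻¹ • x, y⟫ : ℝ)) *
      cexp (I * (‖y‖ ^ 2 : ℝ) / (2 * s)) * φ y) * hc
end

section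
/- Let n ≥ 1, s > 0, and let v be a Schwartz function on ℝⁿ. Define (U₀(s)v)(x) := (2π)^{−n/2} ∫_{ℝⁿ} e^{i x·ξ} e^{−i s|ξ|²/2} v̂(ξ) dξ and (𝒰(s)v)(x) := s^{−n/2} e^{−iπn/4} e^{i|x|²/(2s)} v̂(x/s). Then ‖U₀(s)v − 𝒰(s)v‖_{L²(ℝⁿ)} ≤ (2s)^{−1} · ‖ |x|² v ‖_{L²(ℝⁿ)}. -/
open Real Complex MeasureTheory
open scoped RealInnerProductSpace ENNReal
open scoped FourierTransform SchwartzMap Topology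

section FreePropagator

variable {V : Type*} [NormedAddCommGroup V] [InnerProductSpace ℝ V]

theorem hasTemperateGrowth_cexp_I_mul :
    (fun t : ℝ => cexp (I * t)).HasTemperateGrowth := by
  have hder (k : ℕ) : iteratedDeriv k (fun t : ℝ => cexp (I * t)) =
      fun t : ℝ => I ^ k * cexp (I * t) := by
    induction k with
    | zero => simp
    | succ k ih =>
      rw [iteratedDeriv_succ, ih]
      funext t
      have h : HasDerivAt (fun t : ℝ => cexp (I * t)) (cexp (I * t) * (I * 1)) t :=
        ((hasDerivAt_id (t : ℂ)).comp_ofReal.const_mul I).cexp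
      rw [(h.const_mul (I ^ k)).deriv]
      ring
  refine ⟨(contDiff_const.mul ofRealCLM.contDiff).cexp, fun k => ⟨0, 1, fun t => ?_⟩⟩
  rw [norm_iteratedFDeriv_eq_norm_iteratedDeriv, hder]
  simp [mul_comm I, norm_exp_ofReal_mul_I]

theorem hasTemperateGrowth_cexp_I_mul_norm_sq (a : ℝ) :
    (fun y : V => cexp (I * (a * ‖y‖ ^ 2 : ℝ))).HasTemperateGrowth :=
  hasTemperateGrowth_cexp_I_mul.comp (f := fun y : V => a * ‖y‖ ^ 2) (by fun_prop)

variable [FiniteDimensional ℝ V] [MeasurableSpace V] [BorelSpace V]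

/-- Plancherel's theorem for Schwartz functions, in terms of `eLpNorm`. -/
theorem SchwartzMap.eLpNorm_fourier_two (f : 𝓢(V, ℂ)) :
    eLpNorm (𝓕 (f : V → ℂ)) 2 volume = eLpNorm f 2 volume := by
  have h := SchwartzMap.norm_fourier_toL2_eq f
  rw [SchwartzMap.norm_toLp, SchwartzMap.norm_toLp] at h
  have h₁ : eLpNorm (𝓕 f : 𝓢(V, ℂ)) 2 volume ≠ ∞ :=
    (SchwartzMap.eLpNorm_lt_top (𝓕 f : 𝓢(V, ℂ)) 2 volume).ne
  have h₂ : eLpNorm f 2 volume ≠ ∞ := (f.eLpNorm_lt_top 2 volume).ne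
  rw [← SchwartzMap.fourier_coe]
  exact (ENNReal.toReal_eq_toReal_iff' h₁ h₂).1 h

theorem eLpNorm_two_comp_smul (f : V → ℂ) {r : ℝ} (hr : 0 < r) :
    eLpNorm (fun x => f (r • x)) 2 volume =
      ENNReal.ofReal (r ^ (-(Module.finrank ℝ V : ℝ) / 2)) * eLpNorm f 2 volume := by
  have h := (Homeomorph.smulOfNeZero r hr.ne' (α := V)).measurableEmbedding.eLpNorm_map_measure
    (μ := volume) (g := f) (p := 2)
  rw [show ⇑(Homeomorph.smulOfNeZero r hr.ne' (α := V)) = (r • ·) from rfl,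
    Measure.map_addHaar_smul volume hr.ne', eLpNorm_smul_measure_of_ne_top (by simp)] at h
  rw [← Function.comp_def f (r • ·), ← h, smul_eq_mul]
  congr 1
  rw [abs_of_pos (by positivity), ← Real.rpow_natCast, ← Real.rpow_neg hr.le,
    ENNReal.ofReal_rpow_of_pos (by positivity), ← Real.rpow_mul hr.le]
  congr 2
  simp
  ring

theorem integral_fourier_mul_gaussian {f : V → ℂ} (hf : Integrable f) {b : ℂ} (hb : 0 < b.re)
    (x : V) :
    ∫ ξ, 𝓕 f ξ * cexp (-b * ‖ξ‖ ^ 2 + 2 * π * I * ⟪x, ξ⟫) =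
      (π / b) ^ (Module.finrank ℝ V / 2 : ℂ) *
        ∫ y, f y * cexp (-π ^ 2 * ‖x - y‖ ^ 2 / b) := by
  have h := VectorFourier.integral_fourierIntegral_smul_eq_flip (L := innerₗ V)
    continuous_fourierChar continuous_inner hf
    (GaussianFourier.integrable_cexp_neg_mul_sq_norm_add hb (2 * π * I) x)
  rw [flip_innerₗ] at h
  rw [← integral_const_mul]
  refine h.trans (integral_congr_ae (.of_forall fun y => ?_))
  have h2 := fourier_gaussian_innerProductSpace' hb x y
  change f y • 𝓕 (fun v : V => cexp (-b * ‖v‖ ^ 2 + 2 * π * I * ⟪x, v⟫)) y = _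
  rw [h2, smul_eq_mul]
  ring

/-- The limit case `b = t * I` of `integral_fourier_mul_gaussian`. -/
theorem integral_fourier_mul_imaginary_gaussian {f : V → ℂ} (hf : Integrable f)
    (hf' : Integrable (𝓕 f)) {t : ℝ} (ht : 0 < t) (x : V) :
    ∫ ξ, 𝓕 f ξ * cexp (-(t * I) * ‖ξ‖ ^ 2 + 2 * π * I * ⟪x, ξ⟫) =
      (π / (t * I)) ^ (Module.finrank ℝ V / 2 : ℂ) *
        ∫ y, f y * cexp (-π ^ 2 * ‖x - y‖ ^ 2 / (t * I)) := by
  have htI : (t * I : ℂ) ≠ 0 := by simp [ht.ne']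
  have hb : Filter.Tendsto (fun ε : ℝ => (ε : ℂ) + t * I) (𝓝[>] 0) (𝓝 (t * I)) := by
    have : Continuous fun ε : ℝ => (ε : ℂ) + t * I := by fun_prop
    simpa using (this.tendsto 0).mono_left nhdsWithin_le_nhds
  have hL : Filter.Tendsto (fun ε : ℝ => ∫ ξ, 𝓕 f ξ *
      cexp (-((ε : ℂ) + t * I) * ‖ξ‖ ^ 2 + 2 * π * I * ⟪x, ξ⟫)) (𝓝[>] 0)
      (𝓝 (∫ ξ, 𝓕 f ξ * cexp (-(t * I) * ‖ξ‖ ^ 2 + 2 * π * I * ⟪x, ξ⟫))) := by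
    refine tendsto_integral_filter_of_dominated_convergence (fun ξ => ‖𝓕 f ξ‖)
      (.of_forall fun ε => hf'.1.mul (by fun_prop)) ?_ hf'.norm (.of_forall fun ξ => ?_)
    · filter_upwards [self_mem_nhdsWithin] with ε hε
      refine .of_forall fun ξ => ?_
      rw [norm_mul, Complex.norm_exp]
      refine mul_le_of_le_one_right (norm_nonneg _) (Real.exp_le_one_iff.2 ?_)
      have : 0 ≤ ε * ‖ξ‖ ^ 2 := by have : 0 < ε := hε; positivity
      simpa [← ofReal_pow] using this
    · exact ((Complex.continuous_exp.tendsto _).comp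
        ((hb.neg.mul_const _).add_const _)).const_mul _
  have hR : Filter.Tendsto (fun ε : ℝ => ∫ y, f y *
      cexp (-π ^ 2 * ‖x - y‖ ^ 2 / ((ε : ℂ) + t * I))) (𝓝[>] 0)
      (𝓝 (∫ y, f y * cexp (-π ^ 2 * ‖x - y‖ ^ 2 / (t * I)))) := by
    refine tendsto_integral_filter_of_dominated_convergence (fun y => ‖f y‖)
      (.of_forall fun ε => hf.1.mul (by fun_prop)) ?_ hf.norm (.of_forall fun y => ?_)
    · filter_upwards [self_mem_nhdsWithin] with ε hε
      refine .of_forall fun y => ?_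
      rw [norm_mul, Complex.norm_exp]
      refine mul_le_of_le_one_right (norm_nonneg _) (Real.exp_le_one_iff.2 ?_)
      have hε : 0 < ε := hε
      rw [show (-π ^ 2 * ‖x - y‖ ^ 2 / ((ε : ℂ) + t * I) : ℂ) =
        ((-(π ^ 2 * ‖x - y‖ ^ 2) : ℝ) : ℂ) * ((ε : ℂ) + t * I)⁻¹ by push_cast; ring,
        re_ofReal_mul, Complex.inv_re]
      refine mul_nonpos_of_nonpos_of_nonneg (by simp; positivity)
        (div_nonneg (by simpa using hε.le) (normSq_nonneg _))
    · exact ((Complex.continuous_exp.tendsto _).comp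
        (tendsto_const_nhds.div hb htI)).const_mul _
  have hmem : (π / (t * I) : ℂ) ∈ slitPlane := by
    rw [show (π / (t * I) : ℂ) = ((-(π / t) : ℝ) : ℂ) * I by
      push_cast; field_simp; simp [I_sq, neg_div]]
    right
    simp [ht.ne', pi_ne_zero]
  have hC := ((continuousAt_cpow_const (b := (Module.finrank ℝ V / 2 : ℂ)) hmem).tendsto.comp
    (tendsto_const_nhds (x := (π : ℂ)).div hb htI))
  refine tendsto_nhds_unique hL ((hC.mul hR).congr' ?_)
  filter_upwards [self_mem_nhdsWithin] with ε hε
  exact (integral_fourier_mul_gaussian hf (by simpa using hε) x).symm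

theorem two_pi_rpow_mul_cpow_eq (d : ℕ) {s : ℝ} (hs : 0 < s) :
    (((2 * π) ^ (-(d : ℝ) / 2) : ℝ) : ℂ) * (((2 * π) ^ d : ℝ) *
      (π / ((2 * π ^ 2 * s : ℝ) * I)) ^ (d / 2 : ℂ)) =
    ((s ^ (-(d : ℝ) / 2) : ℝ) : ℂ) * cexp (-I * π * d / 4) := by
  have h2 : (0 : ℝ) < 2 * π := by positivity
  have hπ : (π : ℂ) ≠ 0 := by simp [pi_ne_zero]
  have hs' : (s : ℂ) ≠ 0 := by simp [hs.ne']
  have h : (π / ((2 * π ^ 2 * s : ℝ) * I) : ℂ) = (((2 * π * s)⁻¹ : ℝ) : ℂ) * (-I) := by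
    push_cast
    field_simp
    simp [I_sq]
  have hlog : Complex.log (π / ((2 * π ^ 2 * s : ℝ) * I)) =
      (-(Real.log (2 * π) + Real.log s) : ℝ) + -(π / 2) * I := by
    rw [h, log_ofReal_mul (by positivity) (by simp), log_neg_I, Real.log_inv,
      Real.log_mul h2.ne' hs.ne']
  have hne : (π / ((2 * π ^ 2 * s : ℝ) * I) : ℂ) ≠ 0 := by
    rw [h]
    simp [hs.ne', pi_ne_zero]
  rw [cpow_def_of_ne_zero hne, hlog, ← Real.rpow_natCast, Real.rpow_def_of_pos h2,
    Real.rpow_def_of_pos h2, Real.rpow_def_of_pos hs]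
  simp only [ofReal_exp, ← Complex.exp_add]
  congr 1
  push_cast
  ring

/-- The `MDFM` factorization of the free Schrödinger propagator. -/
theorem freePropagator_eq_fourier {f : V → ℂ} (hf : Integrable f) (hf' : Integrable (𝓕 f))
    {s : ℝ} (hs : 0 < s) (x : V) :
    (((2 * π) ^ (-(Module.finrank ℝ V : ℝ) / 2) : ℝ) : ℂ) *
      ∫ ξ, cexp (I * ⟪x, ξ⟫) * cexp (-I * s * (‖ξ‖ ^ 2 : ℝ) / 2) * 𝓕 f ((2 * π)⁻¹ • ξ) =
    ((s ^ (-(Module.finrank ℝ V : ℝ) / 2) : ℝ) : ℂ) * cexp (-I * π * Module.finrank ℝ V / 4) *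
      cexp (I * (‖x‖ ^ 2 : ℝ) / (2 * s)) *
        𝓕 (fun y => cexp (I * ((2 * s)⁻¹ * ‖y‖ ^ 2 : ℝ)) * f y) ((2 * π * s)⁻¹ • x) := by
  have hπ : (π : ℂ) ≠ 0 := by simp [pi_ne_zero]
  have hs' : (s : ℂ) ≠ 0 := by simp [hs.ne']
  have hscale : ∫ ξ, cexp (I * ⟪x, ξ⟫) * cexp (-I * s * (‖ξ‖ ^ 2 : ℝ) / 2) *
        𝓕 f ((2 * π)⁻¹ • ξ) =
      ((2 * π) ^ Module.finrank ℝ V : ℝ) * ∫ ξ, 𝓕 f ξ *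
        cexp (-((2 * π ^ 2 * s : ℝ) * I) * ‖ξ‖ ^ 2 + 2 * π * I * ⟪x, ξ⟫) := by
    have h := Measure.integral_comp_smul (μ := volume) (fun ξ : V => 𝓕 f ξ *
        cexp (-((2 * π ^ 2 * s : ℝ) * I) * ‖ξ‖ ^ 2 + 2 * π * I * ⟪x, ξ⟫)) (2 * π)⁻¹
    rw [inv_pow, inv_inv, abs_of_pos (by positivity), real_smul] at h
    rw [← h]
    refine integral_congr_ae (.of_forall fun ξ => ?_)
    simp only [norm_smul, inner_smul_right, norm_inv, Real.norm_eq_abs,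
      abs_of_pos (show (0 : ℝ) < 2 * π by positivity)]
    rw [← Complex.exp_add, mul_comm]
    congr 2
    push_cast
    field_simp
    ring
  have hfourier : ∫ y, f y * cexp (-π ^ 2 * ‖x - y‖ ^ 2 / ((2 * π ^ 2 * s : ℝ) * I)) =
      cexp (I * (‖x‖ ^ 2 : ℝ) / (2 * s)) *
        𝓕 (fun y => cexp (I * ((2 * s)⁻¹ * ‖y‖ ^ 2 : ℝ)) * f y) ((2 * π * s)⁻¹ • x) := by
    rw [Real.fourier_eq', ← integral_const_mul]
    refine integral_congr_ae (.of_forall fun y => ?_)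
    simp only [smul_eq_mul, inner_smul_right]
    rw [mul_left_comm (cexp _) (cexp _) (f y), ← mul_assoc, ← mul_assoc, mul_comm (f y),
      ← Complex.exp_add, ← Complex.exp_add]
    congr 2
    rw [← ofReal_pow ‖x - y‖, norm_sub_sq_real, real_inner_comm]
    push_cast
    field_simp
    rw [I_sq]
    ring
  rw [hscale, integral_fourier_mul_imaginary_gaussian hf hf' (by positivity), hfourier,
    ← two_pi_rpow_mul_cpow_eq _ hs]
  ring

end FreePropagator

/-- The free propagator `U₀(s) = e^{-isp²/2}` is approximated in `L²` by its
stationary-phase factorization `𝒰(s) = M(s)D(s)ℱ`, with error at most `(2s)⁻¹ ‖|x|²v‖`. -/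
theorem stmt_10 (n : ℕ) (hn : 1 ≤ n) (s : ℝ) (hs : 0 < s)
    (v : SchwartzMap (EuclideanSpace ℝ (Fin n)) ℂ)
    (vhat U₀v 𝒰v : EuclideanSpace ℝ (Fin n) → ℂ)
    (hvhat : ∀ ξ, vhat ξ =
      ((2 * Real.pi) ^ (-(n : ℝ) / 2) : ℝ) *
        ∫ y : EuclideanSpace ℝ (Fin n),
          Complex.exp (-Complex.I * (⟪y, ξ⟫ : ℝ)) * v y)
    (hU₀ : ∀ x, U₀v x =
      ((2 * Real.pi) ^ (-(n : ℝ) / 2) : ℝ) *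
        ∫ ξ : EuclideanSpace ℝ (Fin n),
          Complex.exp (Complex.I * (⟪x, ξ⟫ : ℝ)) *
            Complex.exp (-Complex.I * s * (‖ξ‖ ^ 2 : ℝ) / 2) * vhat ξ)
    (h𝒰 : ∀ x, 𝒰v x =
      ((s ^ (-(n : ℝ) / 2) : ℝ) : ℂ) * Complex.exp (-Complex.I * Real.pi * n / 4) *
        Complex.exp (Complex.I * (‖x‖ ^ 2 : ℝ) / (2 * s)) * vhat (s⁻¹ • x)) :
    eLpNorm (fun x => U₀v x - 𝒰v x) 2 volume ≤
      ENNReal.ofReal ((2 * s)⁻¹) *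
        eLpNorm (fun x : EuclideanSpace ℝ (Fin n) => ((‖x‖ ^ 2 : ℝ) : ℂ) * v x) 2 volume := by
  have hvhat' (ξ) : vhat ξ = ((2 * π) ^ (-(n : ℝ) / 2) : ℝ) * 𝓕 (v : _ → ℂ) ((2 * π)⁻¹ • ξ) := by
    rw [hvhat, Real.fourier_eq']
    congr 2
    funext y
    rw [inner_smul_right, smul_eq_mul]
    congr 2
    have : (π : ℂ) ≠ 0 := by simp [pi_ne_zero]
    push_cast
    field_simp
  have hgrowth := hasTemperateGrowth_cexp_I_mul_norm_sq (V := EuclideanSpace ℝ (Fin n)) (2 * s)⁻¹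
  let w : 𝓢(EuclideanSpace ℝ (Fin n), ℂ) := SchwartzMap.smulLeftCLM ℂ
    (fun y : EuclideanSpace ℝ (Fin n) => cexp (I * ((2 * s)⁻¹ * ‖y‖ ^ 2 : ℝ))) v
  have hw_apply (y) : w y = cexp (I * ((2 * s)⁻¹ * ‖y‖ ^ 2 : ℝ)) * v y :=
    SchwartzMap.smulLeftCLM_apply_apply hgrowth v y
  have hv' : Integrable (𝓕 (v : EuclideanSpace ℝ (Fin n) → ℂ)) := by
    rw [← SchwartzMap.fourier_coe]
    exact (𝓕 v).integrable
  have hdiff (x) : U₀v x - 𝒰v x = ((2 * π) ^ (-(n : ℝ) / 2) : ℝ) *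
      (((s ^ (-(n : ℝ) / 2) : ℝ) : ℂ) * cexp (-I * π * n / 4) *
        cexp (I * (‖x‖ ^ 2 : ℝ) / (2 * s))) *
        𝓕 ((w - v : 𝓢(EuclideanSpace ℝ (Fin n), ℂ)) : _ → ℂ) ((2 * π * s)⁻¹ • x) := by
    have h := freePropagator_eq_fourier v.integrable hv' hs x
    rw [finrank_euclideanSpace_fin, show (fun y : EuclideanSpace ℝ (Fin n) =>
      cexp (I * ((2 * s)⁻¹ * ‖y‖ ^ 2 : ℝ)) * v y) = w from (funext hw_apply).symm] at h
    have hsub : 𝓕 ((w - v : 𝓢(EuclideanSpace ℝ (Fin n), ℂ)) : _ → ℂ) =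
        𝓕 (w : _ → ℂ) - 𝓕 (v : _ → ℂ) := by
      simp only [← SchwartzMap.fourier_coe]
      ext y
      rw [← FourierTransform.fourierCLM_apply (R := ℂ), map_sub]
      rfl
    rw [hU₀, h𝒰, hvhat', hsub, Pi.sub_apply, smul_smul, ← mul_inv, mul_sub,
      mul_assoc _ _ (𝓕 (w : _ → ℂ) _), ← h]
    simp only [hvhat']
    simp only [mul_left_comm _ (((2 * π) ^ (-(n : ℝ) / 2) : ℝ) : ℂ), integral_const_mul]
    ring
  calc eLpNorm (fun x => U₀v x - 𝒰v x) 2 volume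
      ≤ ENNReal.ofReal ((2 * π * s) ^ (-(n : ℝ) / 2)) * eLpNorm (fun x =>
        𝓕 ((w - v : 𝓢(EuclideanSpace ℝ (Fin n), ℂ)) : _ → ℂ) ((2 * π * s)⁻¹ • x)) 2 volume := by
        refine eLpNorm_le_mul_eLpNorm_of_ae_le_mul (.of_forall fun x => ?_) 2
        have h₁ : ‖cexp (-I * π * n / 4)‖ = 1 := by
          rw [show -I * π * n / 4 = ((-(π * n / 4) : ℝ) : ℂ) * I by push_cast; ring,
            norm_exp_ofReal_mul_I]
        have h₂ : ‖cexp (I * (‖x‖ ^ 2 : ℝ) / (2 * s))‖ = 1 := by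
          rw [show I * (‖x‖ ^ 2 : ℝ) / (2 * s) = ((‖x‖ ^ 2 / (2 * s) : ℝ) : ℂ) * I by
            push_cast; ring, norm_exp_ofReal_mul_I]
        rw [hdiff, norm_mul, norm_mul, norm_mul, norm_mul, h₁, h₂, norm_real, norm_real,
          Real.norm_of_nonneg (by positivity), Real.norm_of_nonneg (by positivity),
          Real.mul_rpow (by positivity) hs.le, mul_one, mul_one]
    _ = eLpNorm (w - v : 𝓢(EuclideanSpace ℝ (Fin n), ℂ)) 2 volume := by
        have hr : (0 : ℝ) < 2 * π * s := by positivity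
        rw [eLpNorm_two_comp_smul _ (inv_pos.2 hr), SchwartzMap.eLpNorm_fourier_two,
          finrank_euclideanSpace_fin, ← mul_assoc, ← ENNReal.ofReal_mul (by positivity),
          ← Real.mul_rpow hr.le (by positivity), mul_inv_cancel₀ hr.ne']
        simp
    _ ≤ _ := by
        refine eLpNorm_le_mul_eLpNorm_of_ae_le_mul (.of_forall fun y => ?_) 2
        rw [sub_apply, hw_apply, ← sub_one_mul, norm_mul, norm_mul, ← mul_assoc]
        gcongr
        refine Real.norm_exp_I_mul_ofReal_sub_one_le.trans (le_of_eq ?_)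
        rw [norm_real, norm_mul, Real.norm_of_nonneg (show 0 ≤ (2 * s)⁻¹ by positivity)]
end

section
/- Let n ≥ 1 and let φ be a Schwartz function on ℝⁿ. For t > 1 define F(t,x) := (log t)^{−n/2} e^{−iπn/4} e^{i|x|²/(2 log t)} φ̂(x/log t), i.e. F(t,·) = 𝒰(t)φ with 𝒰(t) = M(log t)D(log t)F. Then for every t > 1 and x ∈ ℝⁿ: ∂_t F(t,x) = (i/(2t))·(Δ_x F)(t,x) + (i/(2 t (log t)²))·G(t,x), where G(t,·) = 𝒰(t)(y ↦ |y|² φ(y)), i.e. G(t,x) = (log t)^{−n/2} e^{−iπn/4} e^{i|x|²/(2 log t)} · (F[y ↦ |y|²φ(y)])(x/log t). -/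
open Real Complex MeasureTheory
open scoped RealInnerProductSpace

open scoped SchwartzMap FourierTransform LineDeriv

section

variable {E : Type*} [NormedAddCommGroup E] [InnerProductSpace ℝ E]

theorem hasFDerivAt_cexp_norm_sq (s : ℝ) (x : E) :
    HasFDerivAt (fun y : E => cexp (I * (‖y‖ ^ 2 : ℝ) / (2 * s)))
      ((cexp (I * (‖x‖ ^ 2 : ℝ) / (2 * s)) * (I / s)) •
        (ofRealCLM ∘L innerSL ℝ x)) x := by
  have h1 : HasFDerivAt (fun y : E => ((‖y‖ ^ 2 : ℝ) : ℂ))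
      (ofRealCLM ∘L (2 • innerSL ℝ x)) x :=
    ofRealCLM.hasFDerivAt.comp (g := ofRealCLM) x (hasStrictFDerivAt_norm_sq x).hasFDerivAt
  have h2 := (h1.const_mul (I / (2 * s))).cexp
  refine (h2.congr_fderiv ?_).congr_of_eventuallyEq (.of_forall fun y => ?_)
  · ext m
    simp
    ring_nf
  · simp only []
    ring_nf

theorem fderiv_cexp_norm_sq_mul_comp_smul (s r : ℝ) (x m : E) {f : E → ℂ}
    (hf : DifferentiableAt ℝ f (r • x)) :
    fderiv ℝ (fun y : E => cexp (I * (‖y‖ ^ 2 : ℝ) / (2 * s)) * f (r • y)) x m =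
      cexp (I * (‖x‖ ^ 2 : ℝ) / (2 * s)) *
        (I / s * (⟪x, m⟫ : ℝ) * f (r • x) + r * fderiv ℝ f (r • x) m) := by
  have h1 : HasFDerivAt (fun y : E => f (r • y))
      (fderiv ℝ f (r • x) ∘L (r • ContinuousLinearMap.id ℝ E)) x :=
    HasFDerivAt.comp x hf.hasFDerivAt ((hasFDerivAt_id x).const_smul r)
  rw [((hasFDerivAt_cexp_norm_sq s x).fun_mul h1).fderiv]
  simp
  ring

theorem fderiv_fderiv_cexp_norm_sq_mul_comp_smul {s r : ℝ} (hs : s ≠ 0) (hr : r ≠ 0) (x m : E)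
    {f : E → ℂ} (hf : ContDiff ℝ 2 f) :
    fderiv ℝ (fun z : E =>
        fderiv ℝ (fun y : E => cexp (I * (‖y‖ ^ 2 : ℝ) / (2 * s)) * f (r • y)) z m) x m =
      cexp (I * (‖x‖ ^ 2 : ℝ) / (2 * s)) *
        (((I / s * (⟪x, m⟫ : ℝ)) ^ 2 + I / s * (‖m‖ ^ 2 : ℝ)) * f (r • x) +
          2 * r * (I / s) * (⟪x, m⟫ : ℝ) * fderiv ℝ f (r • x) m +
          r ^ 2 * fderiv ℝ (fun z => fderiv ℝ f z m) (r • x) m) := by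
  have hf1 : Differentiable ℝ f := hf.differentiable (by norm_num)
  have hf2 : Differentiable ℝ (fun z => fderiv ℝ f z m) :=
    (hf.fderiv_right (m := 1) (by norm_num)).differentiable (by norm_num) |>.clm_apply
      (differentiable_const m)
  have hC : (r : ℂ) ≠ 0 := by exact_mod_cast hr
  have hsC : (s : ℂ) ≠ 0 := by exact_mod_cast hs
  have hstep : (fun z : E =>
      fderiv ℝ (fun y : E => cexp (I * (‖y‖ ^ 2 : ℝ) / (2 * s)) * f (r • y)) z m) =
      fun z => cexp (I * (‖z‖ ^ 2 : ℝ) / (2 * s)) *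
        (fun w => I / (s * r) * ((⟪w, m⟫ : ℝ) * f w) + r * fderiv ℝ f w m) (r • z) := by
    funext z
    rw [fderiv_cexp_norm_sq_mul_comp_smul s r z m (hf1 _)]
    simp only [inner_smul_left]
    push_cast
    simp
    field_simp
  have hin : HasFDerivAt (fun w : E => ((⟪w, m⟫ : ℝ) : ℂ))
      (ofRealCLM ∘L (innerSL ℝ m)) (r • x) := by
    refine (ofRealCLM ∘L (innerSL ℝ m)).hasFDerivAt.congr_of_eventuallyEq
      (.of_forall fun y => ?_)
    simp [real_inner_comm]
  have hd := ((hin.fun_mul (hf1 (r • x)).hasFDerivAt).const_mul (I / (s * r))).fun_add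
    ((hf2 (r • x)).hasFDerivAt.const_mul (r : ℂ))
  rw [hstep, fderiv_cexp_norm_sq_mul_comp_smul s r x m hd.differentiableAt, hd.fderiv]
  simp [inner_smul_left]
  field_simp
  ring

theorem hasDerivAt_rpow_mul_cexp_mul_comp_smul {s : ℝ} (hs : 0 < s) (a b : ℝ) (x : E)
    {f : E → ℂ} (hf : Differentiable ℝ f) :
    HasDerivAt (fun σ : ℝ => ((σ ^ a : ℝ) : ℂ) *
        (cexp (I * (‖x‖ ^ 2 : ℝ) / (2 * σ)) * f ((b * σ⁻¹) • x)))
      (((s ^ a : ℝ) : ℂ) * cexp (I * (‖x‖ ^ 2 : ℝ) / (2 * s)) *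
        ((a / s - I * (‖x‖ ^ 2 : ℝ) / (2 * s ^ 2)) * f ((b * s⁻¹) • x) -
          b / s ^ 2 * fderiv ℝ f ((b * s⁻¹) • x) x)) s := by
  have hsC : (s : ℂ) ≠ 0 := by exact_mod_cast hs.ne'
  have h1 : HasDerivAt (fun σ : ℝ => ((σ ^ a : ℝ) : ℂ)) ((a * s ^ (a - 1) : ℝ) : ℂ) s :=
    (Real.hasDerivAt_rpow_const (Or.inl hs.ne')).ofReal_comp
  have hi : HasDerivAt (fun σ : ℝ => σ⁻¹) (-(s ^ 2)⁻¹) s := hasDerivAt_inv hs.ne'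
  have h2 : HasDerivAt (fun σ : ℝ => cexp (I * (‖x‖ ^ 2 : ℝ) / (2 * σ)))
      (cexp (I * (‖x‖ ^ 2 : ℝ) / (2 * s)) * (I * (‖x‖ ^ 2 : ℝ) / 2 * (-(s ^ 2)⁻¹ : ℝ))) s := by
    have := (hi.ofReal_comp.const_mul (I * (‖x‖ ^ 2 : ℝ) / 2)).cexp
    have he : ∀ σ : ℝ, I * (‖x‖ ^ 2 : ℝ) / 2 * ((σ⁻¹ : ℝ) : ℂ) =
        I * (‖x‖ ^ 2 : ℝ) / (2 * σ) := fun σ => by push_cast; ring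
    simpa only [he] using this
  have h3 : HasDerivAt (fun σ : ℝ => f ((b * σ⁻¹) • x))
      (fderiv ℝ f ((b * s⁻¹) • x) ((b * -(s ^ 2)⁻¹) • x)) s :=
    (hf _).hasFDerivAt.comp_hasDerivAt s ((hi.const_mul b).smul_const x)
  refine (h1.mul (h2.mul h3)).congr_deriv ?_
  rw [Real.rpow_sub_one hs.ne']
  simp
  field_simp
  ring

end

section

variable {E : Type*} [NormedAddCommGroup E] [InnerProductSpace ℝ E] [FiniteDimensional ℝ E]
  [MeasurableSpace E] [BorelSpace E]

theorem integral_cexp_neg_inner_mul (f : E → ℂ) (ξ : E) :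
    ∫ y : E, cexp (-I * (⟪y, ξ⟫ : ℝ)) * f y = 𝓕 f ((2 * π)⁻¹ • ξ) := by
  rw [Real.fourier_eq']
  congr 1
  funext y
  rw [smul_eq_mul, inner_smul_right]
  congr 2
  have : (π : ℂ) ≠ 0 := by exact_mod_cast Real.pi_ne_zero
  push_cast
  field_simp

/-- The Laplacian of the Fourier transform is the transform of multiplication by
`-(2π)² ‖·‖²`. -/
theorem sum_fderiv_fderiv_fourier {ι : Type*} [Fintype ι] (b : OrthonormalBasis ι ℝ E)
    (φ : 𝓢(E, ℂ)) (ξ : E) :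
    ∑ j, fderiv ℝ (fun z => fderiv ℝ (𝓕 φ : 𝓢(E, ℂ)) z (b j)) ξ (b j) =
      -(2 * π) ^ 2 * 𝓕 (fun y => ((‖y‖ ^ 2 : ℝ) : ℂ) * φ y) ξ := by
  have hj : ∀ j, fderiv ℝ (fun z => fderiv ℝ (𝓕 φ : 𝓢(E, ℂ)) z (b j)) ξ (b j) =
      (∂_{b j} (∂_{b j} (𝓕 φ)) : 𝓢(E, ℂ)) ξ := fun j => by
    rw [SchwartzMap.lineDerivOp_apply_eq_fderiv]
    rfl
  have hg : (fun y : E => ‖y‖ ^ 2).HasTemperateGrowth := by fun_prop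
  have hG : ((SchwartzMap.smulLeftCLM ℂ (fun y : E => ‖y‖ ^ 2) φ : 𝓢(E, ℂ)) : E → ℂ) =
      fun y => ((‖y‖ ^ 2 : ℝ) : ℂ) * φ y := by
    funext y
    rw [SchwartzMap.smulLeftCLM_apply_apply hg]
    simp
  rw [← hG, ← SchwartzMap.fourier_coe, Finset.sum_congr rfl fun j _ => hj j,
    ← _root_.sum_apply, ← SchwartzMap.laplacian_eq_sum b,
    SchwartzMap.laplacian_eq_fourierMultiplierCLM]
  have hFF : ∀ y, (𝓕 (𝓕 φ) : 𝓢(E, ℂ)) (-y) = φ y := fun y => by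
    have h : (𝓕⁻ (𝓕 φ) : 𝓢(E, ℂ)) y = φ y := by rw [FourierTransform.fourierInv_fourier_eq]
    rwa [SchwartzMap.fourierInv_coe, Real.fourierInv_eq_fourier_neg,
      ← SchwartzMap.fourier_coe] at h
  have hmul : (SchwartzMap.fourierMultiplierCLM ℂ (fun x : E => ‖x‖ ^ 2) (𝓕 φ) : 𝓢(E, ℂ)) ξ =
      (𝓕 (SchwartzMap.smulLeftCLM ℂ (fun y : E => ‖y‖ ^ 2) φ) : 𝓢(E, ℂ)) ξ := by
    rw [SchwartzMap.fourierMultiplierCLM_apply, SchwartzMap.fourierInv_coe,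
      Real.fourierInv_eq_fourier_comp_neg, SchwartzMap.fourier_coe]
    refine congrFun (congrArg 𝓕 (funext fun y => ?_)) ξ
    simp only [SchwartzMap.smulLeftCLM_apply_apply hg, norm_neg, hFF]
  rw [_root_.smul_apply, hmul, real_smul]
  push_cast
  rfl

end

/-- For `F(t,·) = 𝒰(t)φ = M(log t)D(log t)ℱφ` one has the evolution identity
`∂ₜF = (i/(2t)) Δₓ F + (i/(2t(log t)²)) G`, where `G(t,·) = 𝒰(t)(|y|²φ)`. -/
theorem stmt_14 (n : ℕ) (hn : 1 ≤ n)
    (φ : SchwartzMap (EuclideanSpace ℝ (Fin n)) ℂ)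
    (φhat ψhat : EuclideanSpace ℝ (Fin n) → ℂ)
    (hφhat : ∀ ξ, φhat ξ =
      ((2 * Real.pi) ^ (-(n : ℝ) / 2) : ℝ) *
        ∫ y : EuclideanSpace ℝ (Fin n),
          Complex.exp (-Complex.I * (⟪y, ξ⟫ : ℝ)) * φ y)
    (hψhat : ∀ ξ, ψhat ξ =
      ((2 * Real.pi) ^ (-(n : ℝ) / 2) : ℝ) *
        ∫ y : EuclideanSpace ℝ (Fin n),
          Complex.exp (-Complex.I * (⟪y, ξ⟫ : ℝ)) * (((‖y‖ ^ 2 : ℝ) : ℂ) * φ y))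
    (F G : ℝ → EuclideanSpace ℝ (Fin n) → ℂ)
    (hF : ∀ t, 1 < t → ∀ x, F t x =
      ((Real.log t ^ (-(n : ℝ) / 2) : ℝ) : ℂ) * Complex.exp (-Complex.I * Real.pi * n / 4) *
        Complex.exp (Complex.I * (‖x‖ ^ 2 : ℝ) / (2 * Real.log t)) *
        φhat ((Real.log t)⁻¹ • x))
    (hG : ∀ t, 1 < t → ∀ x, G t x =
      ((Real.log t ^ (-(n : ℝ) / 2) : ℝ) : ℂ) * Complex.exp (-Complex.I * Real.pi * n / 4) *
        Complex.exp (Complex.I * (‖x‖ ^ 2 : ℝ) / (2 * Real.log t)) *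
        ψhat ((Real.log t)⁻¹ • x)) :
    ∀ t, 1 < t → ∀ x : EuclideanSpace ℝ (Fin n),
      deriv (fun τ : ℝ => F τ x) t =
        (Complex.I / (2 * (t : ℂ))) *
            (∑ j : Fin n,
              fderiv ℝ (fun y => fderiv ℝ (F t) y (EuclideanSpace.single j (1 : ℝ))) x
                (EuclideanSpace.single j (1 : ℝ))) +
          (Complex.I / (2 * (t : ℂ) * ((Real.log t : ℂ)) ^ 2)) * G t x := by
  intro t ht x
  have hs : 0 < Real.log t := Real.log_pos ht
  have ht0 : t ≠ 0 := by positivity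
  have htC : (t : ℂ) ≠ 0 := by exact_mod_cast ht0
  have hsC : (Real.log t : ℂ) ≠ 0 := by exact_mod_cast hs.ne'
  have hpi : (π : ℂ) ≠ 0 := by exact_mod_cast Real.pi_ne_zero
  set S : 𝓢(EuclideanSpace ℝ (Fin n), ℂ) := 𝓕 φ with hS
  set C : ℂ := (((2 * Real.pi) ^ (-(n : ℝ) / 2) : ℝ) : ℂ) * cexp (-I * Real.pi * n / 4) with hC
  have hFS : ∀ τ, 1 < τ → ∀ y, F τ y = C * (((Real.log τ ^ (-(n : ℝ) / 2) : ℝ) : ℂ) *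
      (cexp (I * (‖y‖ ^ 2 : ℝ) / (2 * Real.log τ)) *
        S (((2 * π)⁻¹ * (Real.log τ)⁻¹) • y))) := fun τ hτ y => by
    rw [hF τ hτ, hφhat, integral_cexp_neg_inner_mul, smul_smul, hC, hS, SchwartzMap.fourier_coe]
    ring
  have hGS : G t x = C * (((Real.log t ^ (-(n : ℝ) / 2) : ℝ) : ℂ) *
      (cexp (I * (‖x‖ ^ 2 : ℝ) / (2 * Real.log t)) *
        𝓕 (fun y => ((‖y‖ ^ 2 : ℝ) : ℂ) * φ y) (((2 * π)⁻¹ * (Real.log t)⁻¹) • x))) := by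
    rw [hG t ht, hψhat, integral_cexp_neg_inner_mul, smul_smul, hC]
    ring
  have hderiv : deriv (fun τ : ℝ => F τ x) t = _ :=
    ((((hasDerivAt_rpow_mul_cexp_mul_comp_smul hs (-(n : ℝ) / 2) (2 * π)⁻¹ x
      S.differentiable).scomp t (Real.hasDerivAt_log ht0)).const_mul C).congr_of_eventuallyEq
      ((lt_mem_nhds ht).mono fun τ hτ => hFS τ hτ x)).deriv
  set r : ℝ := (2 * π)⁻¹ * (Real.log t)⁻¹ with hr
  have hr0 : r ≠ 0 := by positivity
  set A : ℂ := C * ((Real.log t ^ (-(n : ℝ) / 2) : ℝ) : ℂ) with hA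
  have hFt : F t = fun y => A * (cexp (I * (‖y‖ ^ 2 : ℝ) / (2 * Real.log t)) * S (r • y)) := by
    funext y
    rw [hFS t ht, hA, ← mul_assoc]
  have hlap : ∑ j : Fin n,
      fderiv ℝ (fun y => fderiv ℝ (F t) y (EuclideanSpace.single j (1 : ℝ))) x
        (EuclideanSpace.single j (1 : ℝ)) = A * (cexp (I * (‖x‖ ^ 2 : ℝ) / (2 * Real.log t)) *
        (((I / Real.log t) ^ 2 * (‖x‖ ^ 2 : ℝ) + I / Real.log t * n) * S (r • x) +
          2 * r * (I / Real.log t) * fderiv ℝ S (r • x) x +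
          r ^ 2 * (-(2 * π) ^ 2 *
            𝓕 (fun y => ((‖y‖ ^ 2 : ℝ) : ℂ) * φ y) (r • x)))) := by
    set b := EuclideanSpace.basisFun (Fin n) ℝ with hb
    have hbj : ∀ j, EuclideanSpace.single j (1 : ℝ) = b j := fun j => by simp [hb]
    have hcd : ContDiff ℝ 2 (fun y : EuclideanSpace ℝ (Fin n) =>
        cexp (I * (‖y‖ ^ 2 : ℝ) / (2 * Real.log t)) * S (r • y)) :=
      (((contDiff_const.mul (ofRealCLM.contDiff.comp (contDiff_norm_sq ℝ))).div_const _).cexp).mul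
        ((S.smooth 2).comp (contDiff_id.const_smul r))
    have hterm : ∀ j, fderiv ℝ (fun y => fderiv ℝ (F t) y (b j)) x (b j) = A * (fderiv ℝ
        (fun z => fderiv ℝ (fun y : EuclideanSpace ℝ (Fin n) =>
          cexp (I * (‖y‖ ^ 2 : ℝ) / (2 * Real.log t)) * S (r • y)) z (b j)) x (b j)) := by
      intro j
      have h1 : ∀ y, fderiv ℝ (F t) y (b j) = A * fderiv ℝ (fun y : EuclideanSpace ℝ (Fin n) =>
          cexp (I * (‖y‖ ^ 2 : ℝ) / (2 * Real.log t)) * S (r • y)) y (b j) := fun y => by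
        rw [hFt, fderiv_const_mul (hcd.differentiable (by norm_num) y)]
        rfl
      simp_rw [h1]
      rw [fderiv_const_mul ((((hcd.fderiv_right (m := 1) (by norm_num)).differentiable
        (by norm_num)).clm_apply (differentiable_const (b j))) x)]
      rfl
    have hsq : ∑ j, ((⟪x, b j⟫ : ℝ) : ℂ) ^ 2 = ((‖x‖ ^ 2 : ℝ) : ℂ) := by
      rw [← b.sum_sq_inner_left x]
      push_cast
      rfl
    have hx : ∑ j, ((⟪x, b j⟫ : ℝ) : ℂ) * fderiv ℝ S (r • x) (b j) =
        fderiv ℝ S (r • x) x := by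
      have h := congrArg (fderiv ℝ S (r • x)) (b.sum_repr' x)
      rw [map_sum] at h
      rw [← h]
      refine Finset.sum_congr rfl fun j _ => ?_
      rw [map_smul, real_inner_comm, real_smul]
    simp_rw [hbj, hterm, fderiv_fderiv_cexp_norm_sq_mul_comp_smul hs.ne' hr0 _ _
      (S.smooth 2)]
    rw [← Finset.mul_sum, ← Finset.mul_sum, Finset.sum_add_distrib, Finset.sum_add_distrib,
      ← Finset.mul_sum, ← Finset.sum_mul, Finset.sum_add_distrib]
    simp_rw [mul_pow, mul_assoc, ← Finset.mul_sum]
    rw [hsq, hx, hS, sum_fderiv_fderiv_fourier]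
    simp only [b.norm_eq_one, one_pow, ofReal_one, mul_one, Finset.sum_const, Finset.card_univ,
      Fintype.card_fin, nsmul_eq_mul]
    ring
  rw [hderiv, hlap, hGS, hA, hr]
  simp
  field_simp
  ring_nf
  simp
  ring
end

section
/- Let n ≥ 1 and let V : ℝ × ℝⁿ → ℝ satisfy: |V(t,x)| ≤ C₀ for all (t,x), and |V(t,x)| ≤ C_S (1+|x|)^{−2}(log(1+|x|))^{κ} for all t and all |x| ≥ R₀, where C₀, C_S, R₀ > 0 and 0 ≤ κ < 1. Then for every ε > 0 there exist T₀ ≥ 2 and a nonnegative function g integrable on [T₀,∞) such that for all t ≥ T₀ and all x ∈ ℝⁿ with |x| ≥ (ε/2)·log t, one has |V(t, t^{1/2} x)| ≤ g(t). -/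
open Real MeasureTheory

open Filter Set in
/-- The function `t⁻¹ (log t)^p` is integrable at infinity when `p < -1`. -/
theorem integrableOn_Ioi_inv_mul_log_rpow {p a : ℝ} (hp : p < -1) (ha : 1 < a) :
    IntegrableOn (fun t : ℝ => t⁻¹ * Real.log t ^ p) (Ioi a) := by
  have hp' : p + 1 ≠ 0 := by linarith
  have hderiv : ∀ t ∈ Ici a,
      HasDerivAt (fun t : ℝ => Real.log t ^ (p + 1) / (p + 1)) (t⁻¹ * Real.log t ^ p) t := by
    intro t ht
    have ht' : 1 < t := lt_of_lt_of_le ha ht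
    have h := ((Real.hasDerivAt_log (by linarith : t ≠ 0)).rpow_const (p := p + 1)
      (Or.inl (Real.log_pos ht').ne')).div_const (p + 1)
    refine h.congr_deriv ?_
    rw [add_sub_cancel_right]
    field_simp
  have hlim : Tendsto (fun t : ℝ => Real.log t ^ (p + 1) / (p + 1)) atTop (nhds (0 / (p + 1))) := by
    have h := (tendsto_rpow_neg_atTop (y := -(p + 1)) (by linarith)).comp Real.tendsto_log_atTop
    simp only [neg_neg] at h
    exact h.div_const _
  refine integrableOn_Ioi_deriv_of_nonneg' hderiv (fun t ht => ?_) hlim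
  have ht' : 1 < t := ha.trans ht
  have := Real.log_pos ht'
  positivity

/-- For `κ ∈ [0, 2]`, the function `y⁻² (log y)^κ` is antitone on `[e, ∞)`. -/
theorem rpow_neg_two_mul_log_rpow_antitoneOn {κ : ℝ} (hκ₀ : 0 ≤ κ) (hκ₂ : κ ≤ 2) :
    AntitoneOn (fun y : ℝ => y ^ (-2 : ℝ) * Real.log y ^ κ) (Set.Ici (Real.exp 1)) := by
  have pos_of_mem {z : ℝ} (hz : z ∈ Set.Ici (Real.exp 1)) : 0 < z := (Real.exp_pos 1).trans_le hz
  have log_nonneg {z : ℝ} (hz : z ∈ Set.Ici (Real.exp 1)) : 0 ≤ Real.log z :=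
    Real.log_nonneg ((Real.one_le_exp zero_le_one).trans hz)
  have key {z : ℝ} (hz : z ∈ Set.Ici (Real.exp 1)) :
      z ^ (-2 : ℝ) * Real.log z ^ κ = (Real.log z / z) ^ κ * z ^ (κ - 2) := by
    have hz₀ := pos_of_mem hz
    rw [Real.div_rpow (log_nonneg hz) hz₀.le, sub_eq_add_neg, Real.rpow_add hz₀]
    have := (Real.rpow_pos_of_pos hz₀ κ).ne'
    field_simp
  intro s hs y hy hsy
  have hs₀ := pos_of_mem hs
  have hy₀ := pos_of_mem hy
  simp only [key hs, key hy]
  have h₁ : Real.log y / y ≤ Real.log s / s := Real.log_div_self_antitoneOn hs hy hsy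
  have h₂ : 0 ≤ Real.log y / y := div_nonneg (log_nonneg hy) hy₀.le
  exact mul_le_mul (Real.rpow_le_rpow h₂ h₁ hκ₀)
    (Real.rpow_le_rpow_of_nonpos hs₀ hsy (by linarith))
    (Real.rpow_nonneg hy₀.le _) (Real.rpow_nonneg (h₂.trans h₁) _)

/-- Short-range integrability estimate: if `|V(t,x)| ≤ C₀` everywhere and
`|V(t,x)| ≤ C_S (1+|x|)⁻² (log(1+|x|))^κ` for `|x| ≥ R₀` with `0 ≤ κ < 1`, then for each
`ε > 0` there are `T₀ ≥ 2` and an integrable `g ≥ 0` on `[T₀,∞)` dominating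
`|V(t, t^(1/2) x)|` on the region `|x| ≥ (ε/2) log t`. -/
theorem stmt_17 (n : ℕ) (hn : 1 ≤ n)
    (V : ℝ → EuclideanSpace ℝ (Fin n) → ℝ)
    (C₀ C_S R₀ κ : ℝ) (hC₀ : 0 < C₀) (hCS : 0 < C_S) (hR₀ : 0 < R₀)
    (hκ₀ : 0 ≤ κ) (hκ₁ : κ < 1)
    (hbdd : ∀ t x, |V t x| ≤ C₀)
    (hdecay : ∀ t (x : EuclideanSpace ℝ (Fin n)), R₀ ≤ ‖x‖ →
      |V t x| ≤ C_S * (1 + ‖x‖) ^ (-2 : ℝ) * Real.log (1 + ‖x‖) ^ κ) :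
    ∀ ε : ℝ, 0 < ε →
      ∃ (T₀ : ℝ) (g : ℝ → ℝ), 2 ≤ T₀ ∧ (∀ t, 0 ≤ g t) ∧
        IntegrableOn g (Set.Ici T₀) volume ∧
        ∀ t, T₀ ≤ t → ∀ x : EuclideanSpace ℝ (Fin n),
          (ε / 2) * Real.log t ≤ ‖x‖ → |V t ((t ^ ((1 : ℝ) / 2) : ℝ) • x)| ≤ g t := by
  intro ε hε
  have hlarge : Filter.Tendsto (fun t : ℝ => t ^ ((1 : ℝ) / 2) * (ε / 2 * Real.log t))
      Filter.atTop Filter.atTop :=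
    (tendsto_rpow_atTop (by norm_num)).atTop_mul_atTop₀
      (Real.tendsto_log_atTop.const_mul_atTop (half_pos hε))
  have hsmall : ∀ᶠ t : ℝ in Filter.atTop, ε / 2 * Real.log t ≤ t ^ ((1 : ℝ) / 2) := by
    filter_upwards [((isLittleO_log_rpow_atTop (r := (1 : ℝ) / 2) (by norm_num)).const_mul_left
      (ε / 2)).bound one_pos, Filter.eventually_ge_atTop 0] with t ht ht₀
    rw [one_mul, Real.norm_of_nonneg (Real.rpow_nonneg ht₀ _)] at ht
    exact (le_abs_self _).trans ht
  obtain ⟨T, hT⟩ := Filter.eventually_atTop.1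
    ((hlarge.eventually_ge_atTop (max R₀ (Real.exp 1))).and hsmall)
  refine ⟨max T 2, fun t => |C_S * (ε / 2) ^ (-2 : ℝ) * (t⁻¹ * Real.log t ^ (κ - 2))|,
    le_max_right _ _, fun t => abs_nonneg _, ?_, ?_⟩
  · rw [integrableOn_Ici_iff_integrableOn_Ioi]
    exact ((integrableOn_Ioi_inv_mul_log_rpow (by linarith)
      (lt_max_of_lt_right one_lt_two)).const_mul _).abs
  intro t ht x hx
  obtain ⟨hρ, hle⟩ := hT t ((le_max_left _ _).trans ht)
  have ht₂ : 2 ≤ t := (le_max_right _ _).trans ht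
  have ht₀ : 0 < t := by linarith
  have hlog : 0 < Real.log t := Real.log_pos (by linarith)
  have hsq : t ^ ((1 : ℝ) / 2) * t ^ ((1 : ℝ) / 2) = t := by
    rw [← Real.rpow_add ht₀]; norm_num
  have hq : 0 < t ^ ((1 : ℝ) / 2) := Real.rpow_pos_of_pos ht₀ _
  set ρ := t ^ ((1 : ℝ) / 2) * (ε / 2 * Real.log t) with hρ_def
  have hexp : Real.exp 1 ≤ ρ := (le_max_right _ _).trans hρ
  have hnorm : ρ ≤ ‖(t ^ ((1 : ℝ) / 2) : ℝ) • x‖ := by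
    rw [norm_smul, Real.norm_of_nonneg hq.le]
    exact mul_le_mul_of_nonneg_left hx hq.le
  have hρ₁ : 1 ≤ ρ := (Real.one_le_exp zero_le_one).trans hexp
  have hρt : ρ ≤ t := (mul_le_mul_of_nonneg_left hle hq.le).trans_eq hsq
  have hρ₂ : ρ ^ (-2 : ℝ) = (ε / 2) ^ (-2 : ℝ) * (t⁻¹ * Real.log t ^ (-2 : ℝ)) := by
    rw [hρ_def, Real.mul_rpow hq.le (by positivity), Real.mul_rpow (by positivity) hlog.le,
      ← Real.rpow_mul ht₀.le, show (1 : ℝ) / 2 * -2 = -1 by norm_num, Real.rpow_neg_one]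
    ring
  refine le_trans ?_ (le_abs_self _)
  calc |V t ((t ^ ((1 : ℝ) / 2) : ℝ) • x)|
      ≤ C_S * ((1 + ‖(t ^ ((1 : ℝ) / 2) : ℝ) • x‖) ^ (-2 : ℝ) *
          Real.log (1 + ‖(t ^ ((1 : ℝ) / 2) : ℝ) • x‖) ^ κ) := by
        rw [← mul_assoc]
        exact hdecay t _ (((le_max_left _ _).trans hρ).trans hnorm)
    _ ≤ C_S * (ρ ^ (-2 : ℝ) * Real.log ρ ^ κ) :=
        mul_le_mul_of_nonneg_left
          (rpow_neg_two_mul_log_rpow_antitoneOn hκ₀ (by linarith) hexp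
            (show Real.exp 1 ≤ 1 + ‖(t ^ ((1 : ℝ) / 2) : ℝ) • x‖ by linarith) (by linarith)) hCS.le
    _ ≤ C_S * (ρ ^ (-2 : ℝ) * Real.log t ^ κ) := by
        have := Real.log_nonneg hρ₁
        gcongr
    _ = C_S * (ε / 2) ^ (-2 : ℝ) * (t⁻¹ * Real.log t ^ (κ - 2)) := by
        rw [hρ₂, sub_eq_add_neg, Real.rpow_add hlog]
        ring
end
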